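/- Let K be a field, r ≥ 1 a natural number, V a K-vector space with dim_K V = r, and N : V → V a K-linear endomorphism with N^r = 0 and N^{r-1} ≠ 0 (so N consists of a single Jordan block of size r). Let (V_i)_{i ∈ ℤ} be a monodromy filtration for (V, N, r). Then: (a) dim_K(V_i/V_{i-1}) = 1 for every integer i with |i| ≤ r-1 and i ≡ r-1 (mod 2), and V_i/V_{i-1} = 0 for all other integers i; (b) for every natural number k with 0 ≤ k ≤ r-1, V_{r-1-2k} equals the image of N^k. -/

import Mathlib

/-- A monodromy filtration for `(V, N, r)`: an increasing family `(F i)_{i ∈ ℤ}` of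
subspaces of `V` such that `F r = V`, `F (-r) = 0`, `N (F i) ⊆ F (i - 2)` for all `i`,
and for every `i ≥ 0` the map induced by `N ^ i` is an isomorphism from
`F i / F (i - 1)` onto `F (-i) / F (-i - 1)` (expressed elementwise: `N ^ i` maps
`F i` into `F (-i)`, the induced map on quotients is injective, and it is surjective). -/
def IsMonodromyFiltration {K V : Type*} [Field K] [AddCommGroup V] [Module K V]
    (N : V →ₗ[K] V) (r : ℕ) (F : ℤ → Submodule K V) : Prop :=
  (∀ i : ℤ, F i ≤ F (i + 1)) ∧
  F (r : ℤ) = ⊤ ∧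
  F (-(r : ℤ)) = ⊥ ∧
  (∀ i : ℤ, (F i).map N ≤ F (i - 2)) ∧
  (∀ i : ℕ,
    (∀ x ∈ F (i : ℤ), (N ^ i) x ∈ F (-(i : ℤ))) ∧
    (∀ x ∈ F (i : ℤ), (N ^ i) x ∈ F (-(i : ℤ) - 1) → x ∈ F ((i : ℤ) - 1)) ∧
    (∀ y ∈ F (-(i : ℤ)), ∃ x ∈ F (i : ℤ), y - (N ^ i) x ∈ F (-(i : ℤ) - 1)))

open Module

/-- The ranks of the powers of a single nilpotent Jordan block. -/
theorem finrank_range_pow_add_eq_of_jordanBlock {K V : Type*} [Field K] [AddCommGroup V]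
    [Module K V] [FiniteDimensional K V] {r : ℕ} (hdim : finrank K V = r)
    {N : V →ₗ[K] V} (hN : N ^ r = 0) (hN' : N ^ (r - 1) ≠ 0) {k : ℕ} (hk : k ≤ r) :
    finrank K (LinearMap.range (N ^ k)) + k = r := by
  have hmap : ∀ k, LinearMap.range (N ^ (k + 1)) = (LinearMap.range (N ^ k)).map N := by
    intro k
    rw [pow_succ', Module.End.mul_eq_comp, LinearMap.range_comp]
  have hle : ∀ k, LinearMap.range (N ^ (k + 1)) ≤ LinearMap.range (N ^ k) := by
    intro k
    rw [pow_succ, Module.End.mul_eq_comp]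
    exact LinearMap.range_comp_le_range _ _
  have hlt : ∀ k < r, finrank K (LinearMap.range (N ^ (k + 1))) <
      finrank K (LinearMap.range (N ^ k)) := by
    intro k hk
    refine Submodule.finrank_lt_finrank_of_lt (lt_of_le_of_ne (hle k) fun heq => hN' ?_)
    have hstab : ∀ m, LinearMap.range (N ^ (k + m)) = LinearMap.range (N ^ k) := by
      intro m
      induction m with
      | zero => rfl
      | succ m ih => rw [← add_assoc, hmap, ih, ← hmap, heq]
    have hr1 := hstab (r - 1 - k)
    have hr2 := hstab (r - k)
    rw [show k + (r - 1 - k) = r - 1 by omega] at hr1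
    rw [show k + (r - k) = r by omega, hN, LinearMap.range_zero] at hr2
    exact LinearMap.range_eq_bot.mp (hr1.trans hr2.symm)
  have hupper : ∀ k ≤ r, finrank K (LinearMap.range (N ^ k)) + k ≤ r := by
    intro k
    induction k with
    | zero => intro _; exact (add_zero _).trans_le ((Submodule.finrank_le _).trans_eq hdim)
    | succ k ih =>
      intro hk
      have h1 := ih (by omega)
      have h2 := hlt k hk
      omega
  have hlower : ∀ m ≤ r, m ≤ finrank K (LinearMap.range (N ^ (r - m))) := by
    intro m
    induction m with
    | zero => intro _; exact Nat.zero_le _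
    | succ m ih =>
      intro hm
      have h1 := ih (by omega)
      have h2 := hlt (r - (m + 1)) (by omega)
      rw [show r - (m + 1) + 1 = r - m by omega] at h2
      omega
  have h1 := hupper k hk
  have h2 := hlower (r - k) (by omega)
  rw [show r - (r - k) = k by omega] at h2
  omega

theorem ker_pow_eq_range_pow_of_jordanBlock {K V : Type*} [Field K] [AddCommGroup V]
    [Module K V] [FiniteDimensional K V] {r : ℕ} (hdim : finrank K V = r)
    {N : V →ₗ[K] V} (hN : N ^ r = 0) (hN' : N ^ (r - 1) ≠ 0) {k : ℕ} (hk : k ≤ r) :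
    LinearMap.ker (N ^ (r - k)) = LinearMap.range (N ^ k) := by
  symm
  apply Submodule.eq_of_le_of_finrank_eq
  · rw [LinearMap.range_le_ker_iff, ← Module.End.mul_eq_comp, ← pow_add,
      Nat.sub_add_cancel hk, hN]
  · have h1 := finrank_range_pow_add_eq_of_jordanBlock hdim hN hN' hk
    have h2 := finrank_range_pow_add_eq_of_jordanBlock hdim hN hN' (Nat.sub_le r k)
    have h3 := LinearMap.finrank_range_add_finrank_ker (N ^ (r - k))
    omega

namespace IsMonodromyFiltration

variable {K V : Type*} [Field K] [AddCommGroup V] [Module K V]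
  {N : V →ₗ[K] V} {r : ℕ} {F : ℤ → Submodule K V}

theorem monotone (hF : IsMonodromyFiltration N r F) : Monotone F :=
  monotone_int_of_le_succ hF.1

theorem pow_apply_mem (hF : IsMonodromyFiltration N r F) (k : ℕ) {i : ℤ} {x : V}
    (hx : x ∈ F i) : (N ^ k) x ∈ F (i - 2 * k) := by
  induction k with
  | zero => simpa using hx
  | succ k ih =>
    rw [pow_succ', Module.End.mul_apply]
    have h := hF.2.2.2.1 _ (Submodule.mem_map_of_mem ih)
    rwa [show i - 2 * (k : ℤ) - 2 = i - 2 * ((k + 1 : ℕ) : ℤ) by push_cast; ring] at h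

theorem eq_bot (hF : IsMonodromyFiltration N r F) {i : ℤ} (hi : i ≤ -r) : F i = ⊥ :=
  le_bot_iff.mp ((hF.monotone hi).trans_eq hF.2.2.1)

theorem eq_top (hF : IsMonodromyFiltration N r F) (hN : N ^ r = 0) {i : ℤ}
    (hi : (r : ℤ) - 1 ≤ i) : F i = ⊤ := by
  refine top_le_iff.mp (le_trans (fun x _ => ?_) (hF.monotone hi))
  refine (hF.2.2.2.2 r).2.1 x (hF.2.1 ▸ Submodule.mem_top) ?_
  rw [hN]
  exact zero_mem _

theorem le_ker_pow (hF : IsMonodromyFiltration N r F) {i : ℤ} {k : ℕ}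
    (hi : i - 2 * k ≤ -r) : F i ≤ LinearMap.ker (N ^ k) := by
  intro x hx
  have h := hF.pow_apply_mem k hx
  rwa [hF.eq_bot hi, Submodule.mem_bot] at h

theorem range_pow_le (hF : IsMonodromyFiltration N r F) (hN : N ^ r = 0) (k : ℕ) :
    LinearMap.range (N ^ k) ≤ F ((r : ℤ) - 1 - 2 * k) := by
  rintro _ ⟨x, rfl⟩
  exact hF.pow_apply_mem k (hF.eq_top hN le_rfl ▸ Submodule.mem_top)

variable [FiniteDimensional K V]

theorem eq_range_pow (hF : IsMonodromyFiltration N r F) (hdim : finrank K V = r)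
    (hN : N ^ r = 0) (hN' : N ^ (r - 1) ≠ 0) {k : ℕ} (hk : k ≤ r) :
    F ((r : ℤ) - 1 - 2 * k) = LinearMap.range (N ^ k) := by
  refine le_antisymm ?_ (hF.range_pow_le hN k)
  rw [← ker_pow_eq_range_pow_of_jordanBlock hdim hN hN' hk]
  exact hF.le_ker_pow (by omega)

theorem eq_range_pow_succ (hF : IsMonodromyFiltration N r F) (hdim : finrank K V = r)
    (hN : N ^ r = 0) (hN' : N ^ (r - 1) ≠ 0) {k : ℕ} (hk : k < r) :
    F ((r : ℤ) - 2 - 2 * k) = LinearMap.range (N ^ (k + 1)) := by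
  apply le_antisymm
  · rw [← ker_pow_eq_range_pow_of_jordanBlock hdim hN hN' hk]
    exact hF.le_ker_pow (by omega)
  · exact (hF.range_pow_le hN (k + 1)).trans (hF.monotone (by omega))

end IsMonodromyFiltration

/-- For a single Jordan block of size `r`, the monodromy filtration has one-dimensional
graded pieces exactly in degrees `i` with `|i| ≤ r - 1` and `i ≡ r - 1 (mod 2)`, and
`F (r - 1 - 2k)` is the image of `N ^ k` for `0 ≤ k ≤ r - 1`. -/
theorem monodromyFiltration_jordanBlock (K V : Type*) [Field K] [AddCommGroup V] [Module K V]
    [FiniteDimensional K V] (r : ℕ) (hr : 1 ≤ r) (hdim : finrank K V = r)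
    (N : V →ₗ[K] V) (hN : N ^ r = 0) (hN' : N ^ (r - 1) ≠ 0)
    (F : ℤ → Submodule K V) (hF : IsMonodromyFiltration N r F) :
    (∀ i : ℤ, (|i| ≤ (r : ℤ) - 1 ∧ (2 : ℤ) ∣ (i - ((r : ℤ) - 1))) →
      finrank K (F i) = finrank K (F (i - 1)) + 1) ∧
    (∀ i : ℤ, ¬(|i| ≤ (r : ℤ) - 1 ∧ (2 : ℤ) ∣ (i - ((r : ℤ) - 1))) →
      F i = F (i - 1)) ∧
    (∀ k : ℕ, (k : ℤ) ≤ (r : ℤ) - 1 →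
      F ((r : ℤ) - 1 - 2 * (k : ℤ)) = LinearMap.range (N ^ k)) := by
  refine ⟨fun i hi => ?_, fun i hi => ?_, fun k hk => ?_⟩
  · obtain ⟨habs, c, hc⟩ := hi
    rw [abs_le] at habs
    obtain ⟨k, rfl⟩ : ∃ k : ℕ, i = (r : ℤ) - 1 - 2 * k := ⟨(-c).toNat, by omega⟩
    have hk : k < r := by omega
    rw [show (r : ℤ) - 1 - 2 * k - 1 = r - 2 - 2 * k by ring,
      hF.eq_range_pow hdim hN hN' hk.le, hF.eq_range_pow_succ hdim hN hN' hk]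
    have h1 := finrank_range_pow_add_eq_of_jordanBlock hdim hN hN' hk.le
    have h2 := finrank_range_pow_add_eq_of_jordanBlock hdim hN hN' (k := k + 1) hk
    omega
  · rw [abs_le] at hi
    by_cases hlow : i ≤ -r
    · rw [hF.eq_bot hlow, hF.eq_bot (by omega)]
    by_cases hhigh : (r : ℤ) ≤ i
    · rw [hF.eq_top hN (by omega), hF.eq_top hN (by omega)]
    obtain ⟨k, rfl⟩ : ∃ k : ℕ, i = (r : ℤ) - 2 - 2 * k :=
      ⟨((r - 2 - i) / 2).toNat, by omega⟩
    have hk : k < r := by omega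
    rw [hF.eq_range_pow_succ hdim hN hN' hk, ← hF.eq_range_pow hdim hN hN' hk]
    congr 1
    push_cast
    ring
  · exact hF.eq_range_pow hdim hN hN' (by omega)
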